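/- arXiv:2012.06288 — 2 statements merged into one kernel-verified Lean document; each statement's English description precedes it below -/
import Mathlib

section
/- Let n ≥ 6 be even and let V_n be the Wagner graph (circulant) on ℤ/nℤ. Then for every edge e of V_n, the inequality x_e ≤ 1 is facet-defining for BOND(V_n). -/
open Finset

namespace BondPolytope

variable {V : Type*}

/-- The cut `δ(S)`: edges of `G` with exactly one endpoint in `S`. -/
def cut (G : SimpleGraph V) (S : Set V) : Set (Sym2 V) :=
  {e | e ∈ G.edgeSet ∧ ∃ u w, e = s(u, w) ∧ u ∈ S ∧ w ∉ S}

/-- A set of edges is a cut of `G`. -/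
def IsCut (G : SimpleGraph V) (D : Set (Sym2 V)) : Prop :=
  ∃ S : Set V, D = cut G S

/-- A set of edges is a bond of `G`: it is a cut `δ(S)` such that both sides induce
connected (possibly empty) subgraphs. -/
def IsBond (G : SimpleGraph V) (D : Set (Sym2 V)) : Prop :=
  ∃ S : Set V, D = cut G S ∧ (G.induce S).Preconnected ∧ (G.induce Sᶜ).Preconnected

open Classical in
/-- The indicator vector `x^δ ∈ ℝ^E` of a set `δ` of edges. -/
noncomputable def indVec (G : SimpleGraph V) (D : Set (Sym2 V)) : ↥G.edgeSet → ℝ :=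
  fun e => if (e : Sym2 V) ∈ D then 1 else 0

/-- The bond polytope `BOND(G) ⊆ ℝ^E`. -/
noncomputable def bondPolytope (G : SimpleGraph V) : Set (↥G.edgeSet → ℝ) :=
  convexHull ℝ {x | ∃ D, IsBond G D ∧ x = indVec G D}

/-- The cut polytope `CUT(G) ⊆ ℝ^E`. -/
noncomputable def cutPolytope (G : SimpleGraph V) : Set (↥G.edgeSet → ℝ) :=
  convexHull ℝ {x | ∃ D, IsCut G D ∧ x = indVec G D}

/-- `a^T x`. -/
noncomputable def dot {ι : Type*} [Fintype ι] (a x : ι → ℝ) : ℝ := ∑ i, a i * x i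

/-- Affine dimension of a set of points. -/
noncomputable def affDim {W : Type*} [AddCommGroup W] [Module ℝ W] (s : Set W) : ℕ :=
  Module.finrank ℝ ↥(vectorSpan ℝ s)

/-- `a^T x ≤ b` is facet-defining for `P`. -/
def IsFacet {ι : Type*} [Fintype ι] (P : Set (ι → ℝ)) (a : ι → ℝ) (b : ℝ) : Prop :=
  a ≠ 0 ∧ (∀ x ∈ P, dot a x ≤ b) ∧ {x ∈ P | dot a x = b}.Nonempty ∧
    affDim {x ∈ P | dot a x = b} + 1 = affDim P


/-- The Wagner graph (circulant) `V_n` on `ZMod n`: `i` and `j` are adjacent iff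
`i - j ≡ ±1 (mod n)` or `i - j ≡ n/2 (mod n)`. -/
def wagner (n : ℕ) : SimpleGraph (ZMod n) :=
  SimpleGraph.fromRel (fun i j => i - j = 1 ∨ i - j = (n / 2 : ℕ))


section General

variable {V : Type*} {G : SimpleGraph V}

lemma mem_cut_iff {S : Set V} {x y : V} :
    s(x, y) ∈ cut G S ↔ G.Adj x y ∧ ¬(x ∈ S ↔ y ∈ S) := by
  simp only [cut, Set.mem_ofPred_eq, SimpleGraph.mem_edgeSet]
  refine and_congr_right fun _ => ⟨?_, fun h => ?_⟩
  · rintro ⟨u, w, h, hu, hw⟩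
    rcases Sym2.eq_iff.1 h with ⟨rfl, rfl⟩ | ⟨rfl, rfl⟩ <;> tauto
  · by_cases hx : x ∈ S
    · exact ⟨x, y, rfl, hx, fun hy => h (by tauto)⟩
    · exact ⟨y, x, Sym2.eq_swap, by tauto, hx⟩

lemma dot_indVec_eq [Fintype G.edgeSet] (c : G.edgeSet → ℝ) (D : Set (Sym2 V)) :
    dot c (indVec G D) = ∑ g, c g * indVec G D g := rfl

/-- Second difference of the cut function when two adjacent vertices are added. -/
lemma dot_cut_second_difference [Fintype G.edgeSet] (c : G.edgeSet → ℝ) {S : Set V} {u v : V}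
    (h : G.Adj u v) (hu : u ∉ S) (hv : v ∉ S) :
    dot c (indVec G (cut G (insert u S))) + dot c (indVec G (cut G (insert v S)))
      - dot c (indVec G (cut G S)) - dot c (indVec G (cut G (insert u (insert v S))))
      = 2 * c ⟨s(u, v), h⟩ := by
  classical
  simp only [dot_indVec_eq]
  rw [← Finset.sum_add_distrib, ← Finset.sum_sub_distrib, ← Finset.sum_sub_distrib,
    Finset.sum_eq_single ⟨s(u, v), h⟩]
  · have huv := h.ne
    have hvu := h.ne'
    simp only [indVec, mem_cut_iff, Set.mem_insert_iff]
    simp [h, hu, hv, huv, hvu]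
    ring
  · rintro ⟨g, hg⟩ - hne
    induction g using Sym2.ind with
    | _ x y =>
      rw [SimpleGraph.mem_edgeSet] at hg
      have hxy := hg.ne
      have huv := h.ne
      have hne' : ¬(x = u ∧ y = v) ∧ ¬(x = v ∧ y = u) := by
        constructor <;> rintro ⟨rfl, rfl⟩ <;> simp [Sym2.eq_swap] at hne
      simp only [indVec, mem_cut_iff, Set.mem_insert_iff, hg, true_and]
      by_cases h1 : x = u <;> by_cases h2 : x = v <;> by_cases h3 : y = u <;>
        by_cases h4 : y = v <;> by_cases h5 : x ∈ S <;> by_cases h6 : y ∈ S <;>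
        simp_all
  · simp

/-- If every `c` orthogonal to all bonds through `e` vanishes, then `x_e ≤ 1` defines a facet. -/
lemma isFacet_of_orthogonal_eq_zero [Fintype G.edgeSet] [DecidableEq G.edgeSet] (e : G.edgeSet)
    (hex : ∃ D, IsBond G D ∧ (e : Sym2 V) ∈ D)
    (h : ∀ c : G.edgeSet → ℝ,
      (∀ D, IsBond G D → (e : Sym2 V) ∈ D → dot c (indVec G D) = 0) → c = 0) :
    IsFacet (bondPolytope G) (fun f => if f = e then (1 : ℝ) else 0) 1 := by
  have hdot : ∀ x : G.edgeSet → ℝ, dot (fun f => if f = e then (1 : ℝ) else 0) x = x e := by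
    intro x
    simp [dot]
  have hind : ∀ D, (e : Sym2 V) ∈ D → indVec G D e = 1 := fun D hD => by simp [indVec, hD]
  have hface : ∀ D, IsBond G D → (e : Sym2 V) ∈ D →
      indVec G D ∈ {x ∈ bondPolytope G | x e = 1} := fun D hD he =>
    ⟨subset_convexHull ℝ _ ⟨D, hD, rfl⟩, hind D he⟩
  set B : Set (G.edgeSet → ℝ) := {x | ∃ D, IsBond G D ∧ (e : Sym2 V) ∈ D ∧ x = indVec G D}
  have hspan : Submodule.span ℝ B = ⊤ := by
    by_contra hlt
    obtain ⟨φ, hφ, hle⟩ := Submodule.exists_le_ker_of_lt_top _ (lt_top_iff_ne_top.2 hlt)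
    have hφdot : ∀ x, φ x = dot (fun g => φ (fun j => if g = j then 1 else 0)) x := by
      intro x
      rw [LinearMap.pi_apply_eq_sum_univ φ x]
      simp [dot, mul_comm]
    have hc := h (fun g => φ (fun j => if g = j then 1 else 0)) fun D hD he => by
      rw [← hφdot]
      exact hle (Submodule.subset_span ⟨D, hD, he, rfl⟩)
    apply hφ
    refine LinearMap.ext fun x => ?_
    rw [hφdot, hc]
    simp [dot]
  obtain ⟨D₀, hD₀, he₀⟩ := hex
  refine ⟨fun h0 => ?_, ?_, ?_, ?_⟩
  · simpa using congrFun h0 e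
  · intro x hx
    rw [hdot]
    have hconv : Convex ℝ {x : G.edgeSet → ℝ | x e ≤ 1} :=
      convex_halfSpace_le (LinearMap.proj (R := ℝ) (φ := fun _ : G.edgeSet => ℝ) e).isLinear 1
    refine convexHull_min ?_ hconv hx
    rintro _ ⟨D, -, rfl⟩
    simp only [indVec, Set.mem_ofPred_eq]
    split_ifs <;> norm_num
  · simp only [hdot]
    exact ⟨_, hface D₀ hD₀ he₀⟩
  · simp only [hdot]
    have htop : vectorSpan ℝ (bondPolytope G) = ⊤ := by
      rw [eq_top_iff, ← hspan, Submodule.span_le]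
      rintro _ ⟨D, hD, he, rfl⟩
      have h0 : (0 : G.edgeSet → ℝ) ∈ bondPolytope G := by
        refine subset_convexHull ℝ _ ⟨∅, ⟨Set.univ, ?_, ?_, ?_⟩, ?_⟩
        · ext g
          simp [cut]
        · obtain ⟨S, rfl, hS, hSc⟩ := hD
          induction hes : (e : Sym2 V) using Sym2.ind with
          | _ x y =>
            rw [hes, mem_cut_iff] at he
            by_cases hx : x ∈ S
            · have := (SimpleGraph.connected_induce_union hS hSc hx
                (show y ∈ Sᶜ from fun hy => he.2 (by tauto)) he.1).preconnected
              rwa [Set.union_compl_self] at this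
            · have := (SimpleGraph.connected_induce_union hS hSc
                (show y ∈ S by tauto) (show x ∈ Sᶜ from hx) he.1.symm).preconnected
              rwa [Set.union_compl_self] at this
        · rintro ⟨x, hx⟩
          simp at hx
        · ext g
          simp [indVec]
      have := vsub_mem_vectorSpan ℝ (hface D hD he).1 h0
      simpa using this
    set H := vectorSpan ℝ {x ∈ bondPolytope G | x e = 1} with hH
    have hlt : H < ⊤ := by
      have hle : H ≤ LinearMap.ker (LinearMap.proj (R := ℝ) (φ := fun _ : G.edgeSet => ℝ) e) := by
        rw [hH, vectorSpan_def, Submodule.span_le]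
        rintro _ ⟨x, hx, y, hy, rfl⟩
        simp [hx.2, hy.2]
      refine lt_of_le_of_lt hle (lt_top_iff_ne_top.2 fun ht => ?_)
      have : (fun _ => 1 : G.edgeSet → ℝ) ∈
          LinearMap.ker (LinearMap.proj (R := ℝ) (φ := fun _ : G.edgeSet => ℝ) e) := by
        rw [ht]; trivial
      simp at this
    have h1 := Submodule.finrank_lt_finrank_of_lt hlt
    have hsup : H ⊔ Submodule.span ℝ {indVec G D₀} = ⊤ := by
      rw [eq_top_iff, ← hspan, Submodule.span_le]
      rintro _ ⟨D, hD, he, rfl⟩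
      have := vsub_mem_vectorSpan ℝ (hface D hD he) (hface D₀ hD₀ he₀)
      rw [← sub_add_cancel (indVec G D) (indVec G D₀)]
      exact Submodule.add_mem_sup this (Submodule.mem_span_singleton_self _)
    have h2 := Submodule.finrank_add_le_finrank_add_finrank H (Submodule.span ℝ {indVec G D₀})
    have h3 := finrank_span_le_card (R := ℝ) ({indVec G D₀} : Set (G.edgeSet → ℝ))
    rw [hsup] at h2
    simp only [Set.toFinset_singleton, Finset.card_singleton] at h3
    rw [affDim, affDim, htop]
    change Module.finrank ℝ H + 1 = _
    omega

/-- An edge `uv` has zero coefficient in every `c` orthogonal to the bonds through `ww'` if the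
other vertices split into connected parts separating `w` from `w'`, each meeting the
neighbourhoods of both `u` and `v`. -/
lemma eq_zero_of_separation [Fintype G.edgeSet] {c : G.edgeSet → ℝ} {e : Sym2 V}
    (hc : ∀ D, IsBond G D → e ∈ D → dot c (indVec G D) = 0)
    {A B : Set V} {u v w w' a a' b b' : V} (he : e = s(w, w')) (hww' : G.Adj w w')
    (hw : w ∈ A) (hw' : w' ∈ B) (h : G.Adj u v)
    (hpart : ∀ x, x ∈ B ↔ ¬(x ∈ A ∨ x = u ∨ x = v)) (huA : u ∉ A) (hvA : v ∉ A)
    (hA : (G.induce A).Preconnected) (hB : (G.induce B).Preconnected)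
    (ha : a ∈ A) (hua : G.Adj u a) (ha' : a' ∈ A) (hva : G.Adj v a')
    (hb : b ∈ B) (hub : G.Adj u b) (hb' : b' ∈ B) (hvb : G.Adj v b') :
    c ⟨s(u, v), h⟩ = 0 := by
  have hw'B := (hpart w').1 hw'
  push Not at hw'B
  have hne := h.ne
  have key : ∀ S T : Set V, (G.induce S).Preconnected → (G.induce T).Preconnected → T = Sᶜ →
      w ∈ S → w' ∉ S → dot c (indVec G (cut G S)) = 0 := by
    rintro S _ hS hT rfl hwS hwS'
    refine hc _ ⟨S, rfl, hS, hT⟩ ?_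
    rw [he, mem_cut_iff]
    exact ⟨hww', by tauto⟩
  have cons : ∀ {S : Set V} {x y : V}, (G.induce S).Preconnected → y ∈ S → G.Adj x y →
      (G.induce (insert x S)).Preconnected := by
    intro S x y hS hy hxy
    rw [← Set.singleton_union]
    refine (SimpleGraph.connected_induce_union ?_ hS (Set.mem_singleton x) hy hxy).preconnected
    rintro ⟨p, rfl⟩ ⟨q, rfl⟩
    rfl
  have hAv := cons hA ha' hva
  have hBv := cons hB hb' hvb
  have := dot_cut_second_difference c h huA hvA
  rw [key A _ hA (cons hBv (Set.mem_insert_of_mem _ hb) hub) ?_ hw ?_,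
    key _ _ (cons hA ha hua) hBv ?_ ?_ ?_, key _ _ hAv (cons hB hb hub) ?_ ?_ ?_,
    key _ _ (cons hAv (Set.mem_insert_of_mem _ ha) hua) hB ?_ ?_ ?_] at this
  · linarith
  all_goals
    first
    | ext x
      simp only [Set.mem_insert_iff, Set.mem_compl_iff, hpart x]
      by_cases h1 : x = u <;> by_cases h2 : x = v <;> by_cases h3 : x ∈ A <;> simp_all
    | simp [hw, hw'B]

end General

section Wagner

variable {n : ℕ}

/-- The vertices of `ZMod n` whose offset from `i`, as a number below `n`, satisfies `P`. -/
def offsetSet (i : ZMod n) (P : ℕ → Prop) : Set (ZMod n) := {x | P (x - i).val}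

lemma add_natCast_mem_offsetSet {i : ZMod n} {P : ℕ → Prop} {a : ℕ} (ha : a < n) :
    i + (a : ZMod n) ∈ offsetSet i P ↔ P a := by
  simp [offsetSet, ZMod.val_natCast_of_lt ha]

lemma natCast_eq_natCast_iff_of_lt {a b : ℕ} (ha : a < n) (hb : b < 2 * n) :
    (a : ZMod n) = b ↔ a = b ∨ a + n = b := by
  rw [ZMod.natCast_eq_natCast_iff', Nat.mod_eq_of_lt ha]
  rcases lt_or_ge b n with h | h
  · rw [Nat.mod_eq_of_lt h]
    omega
  · rw [Nat.mod_eq_sub_mod h, Nat.mod_eq_of_lt (by omega)]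
    omega

lemma add_natCast_inj {i : ZMod n} {a b : ℕ} (ha : a < n) (hb : b < n) :
    i + (a : ZMod n) = i + (b : ZMod n) ↔ a = b := by
  rw [add_right_inj, natCast_eq_natCast_iff_of_lt ha (by omega)]
  omega

lemma wagner_adj_iff (hn : 6 ≤ n) (heven : Even n) {i : ZMod n} {a b : ℕ} (ha : a < n)
    (hb : b < n) :
    (wagner n).Adj (i + (a : ZMod n)) (i + (b : ZMod n)) ↔
      (b = a + 1 ∨ b = a + n / 2 ∨ b + 1 = a + n) ∨
        (a = b + 1 ∨ a = b + n / 2 ∨ a + 1 = b + n) := by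
  obtain ⟨m, hm⟩ := heven
  have hsub : ∀ p q : ℕ, p < n → q < n →
      ((i + (p : ZMod n) - (i + (q : ZMod n)) = 1 ∨
        i + (p : ZMod n) - (i + (q : ZMod n)) = (n / 2 : ℕ)) ↔
        (p = q + 1 ∨ p + n = q + 1) ∨ (p = q + n / 2 ∨ p + n = q + n / 2)) := by
    intro p q hp hq
    rw [add_sub_add_left_eq_sub, sub_eq_iff_eq_add', sub_eq_iff_eq_add',
      ← natCast_eq_natCast_iff_of_lt hp (by omega), ← natCast_eq_natCast_iff_of_lt hp (by omega)]
    push_cast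
    rfl
  rw [wagner, SimpleGraph.fromRel_adj, Ne, add_natCast_inj ha hb, hsub a b ha hb, hsub b a hb ha]
  omega

variable [NeZero n]

lemma exists_offset (i x : ZMod n) : ∃ a < n, x = i + (a : ZMod n) :=
  ⟨(x - i).val, ZMod.val_lt _, by simp⟩

lemma preconnected_offsetSet_Icc (hn : 6 ≤ n) (heven : Even n) (i : ZMod n) {a b : ℕ}
    (hb : b < n) :
    ((wagner n).induce (offsetSet i fun k => a ≤ k ∧ k ≤ b)).Preconnected := by
  have hmem : ∀ k, a ≤ k → k ≤ b →
      i + (k : ZMod n) ∈ offsetSet i fun k => a ≤ k ∧ k ≤ b := fun k h1 h2 =>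
    (add_natCast_mem_offsetSet (by omega)).2 ⟨h1, h2⟩
  have hreach : ∀ k (h1 : a ≤ k) (h2 : k ≤ b),
      ((wagner n).induce (offsetSet i fun k => a ≤ k ∧ k ≤ b)).Reachable
        ⟨i + (a : ZMod n), hmem a le_rfl (h1.trans h2)⟩ ⟨i + (k : ZMod n), hmem k h1 h2⟩ := by
    intro k h1
    induction k, h1 using Nat.le_induction with
    | base => exact fun _ => SimpleGraph.Reachable.refl _
    | succ k hk ih =>
      intro h2
      refine (ih (by omega)).trans (SimpleGraph.Adj.reachable ?_)
      rw [SimpleGraph.induce_adj]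
      exact (wagner_adj_iff hn heven (by omega) (by omega)).2 (by omega)
  rintro ⟨x, hx⟩ ⟨y, hy⟩
  obtain ⟨p, hp, rfl⟩ := exists_offset i x
  obtain ⟨q, hq, rfl⟩ := exists_offset i y
  have hp' := (add_natCast_mem_offsetSet hp).1 hx
  have hq' := (add_natCast_mem_offsetSet hq).1 hy
  exact (hreach p hp'.1 hp'.2).symm.trans (hreach q hq'.1 hq'.2)

lemma preconnected_offsetSet_Icc_or_Icc (hn : 6 ≤ n) (heven : Even n) (i : ZMod n)
    {a b a' b' p q : ℕ} (hb : b < n) (hb' : b' < n) (hp : a ≤ p ∧ p ≤ b) (hq : a' ≤ q ∧ q ≤ b')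
    (hpq : (q = p + 1 ∨ q = p + n / 2 ∨ q + 1 = p + n) ∨
      (p = q + 1 ∨ p = q + n / 2 ∨ p + 1 = q + n)) :
    ((wagner n).induce
      (offsetSet i fun k => (a ≤ k ∧ k ≤ b) ∨ (a' ≤ k ∧ k ≤ b'))).Preconnected :=
  (SimpleGraph.connected_induce_union (preconnected_offsetSet_Icc hn heven i hb)
    (preconnected_offsetSet_Icc hn heven i hb')
    ((add_natCast_mem_offsetSet (by omega)).2 hp) ((add_natCast_mem_offsetSet (by omega)).2 hq)
    ((wagner_adj_iff hn heven (by omega) (by omega)).2 hpq)).preconnected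

/-- `eq_zero_of_separation` for the Wagner graph, with vertices given by offsets from `i`. -/
lemma eq_zero_of_offset_separation [Fintype (wagner n).edgeSet] (hn : 6 ≤ n) (heven : Even n)
    {c : (wagner n).edgeSet → ℝ} {e : Sym2 (ZMod n)}
    (hc : ∀ D, IsBond (wagner n) D → e ∈ D → dot c (indVec (wagner n) D) = 0)
    {i : ZMod n} {P Q : ℕ → Prop} {v w w' : ℕ} (a a' b b' : ℕ)
    (he : e = s(i + (w : ZMod n), i + (w' : ZMod n)))
    (h : (wagner n).Adj i (i + (v : ZMod n)))
    (hww' : (wagner n).Adj (i + (w : ZMod n)) (i + (w' : ZMod n)))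
    (hP : ((wagner n).induce (offsetSet i P)).Preconnected)
    (hQ : ((wagner n).induce (offsetSet i Q)).Preconnected)
    (hlt : v < n ∧ w < n ∧ w' < n ∧ a < n ∧ a' < n ∧ b < n ∧ b' < n)
    (hw : (P w ∧ Q w') ∨ (Q w ∧ P w'))
    (hpart : ∀ k < n, Q k ↔ ¬(P k ∨ k = 0 ∨ k = v)) (h0P : ¬P 0) (hvP : ¬P v)
    (ha : P a) (hb : Q b) (ha' : P a') (hb' : Q b')
    (h0a : a = 1 ∨ a = n / 2 ∨ a + 1 = n) (h0b : b = 1 ∨ b = n / 2 ∨ b + 1 = n)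
    (hva : (a' = v + 1 ∨ a' = v + n / 2 ∨ a' + 1 = v + n) ∨
      (v = a' + 1 ∨ v = a' + n / 2 ∨ v + 1 = a' + n))
    (hvb : (b' = v + 1 ∨ b' = v + n / 2 ∨ b' + 1 = v + n) ∨
      (v = b' + 1 ∨ v = b' + n / 2 ∨ v + 1 = b' + n)) :
    c ⟨s(i, i + (v : ZMod n)), h⟩ = 0 := by
  obtain ⟨hv, hwn, hwn', han, han', hbn, hbn'⟩ := hlt
  have hn0 : 0 < n := by omega
  have hi : i + ((0 : ℕ) : ZMod n) = i := by simp
  have hadj0 : ∀ k < n, (k = 1 ∨ k = n / 2 ∨ k + 1 = n) →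
      (wagner n).Adj i (i + (k : ZMod n)) := by
    intro k hk h
    have := (wagner_adj_iff hn heven (i := i) hn0 hk).2 (by omega)
    rwa [hi] at this
  have hiP : i ∉ offsetSet i P := by
    have := mt (add_natCast_mem_offsetSet (i := i) hn0).1 h0P
    rwa [hi] at this
  have hsep : ∀ x, x ∈ offsetSet i Q ↔
      ¬(x ∈ offsetSet i P ∨ x = i ∨ x = i + (v : ZMod n)) := by
    intro x
    obtain ⟨k, hk, rfl⟩ := exists_offset i x
    have hk0 : i + (k : ZMod n) = i ↔ k = 0 := by
      rw [← add_natCast_inj (i := i) hk hn0, hi]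
    rw [add_natCast_mem_offsetSet hk, add_natCast_mem_offsetSet hk, hk0, add_natCast_inj hk hv]
    exact hpart k hk
  have main : ∀ p q : ℕ, p < n → q < n → P p → Q q →
      e = s(i + (p : ZMod n), i + (q : ZMod n)) →
      (wagner n).Adj (i + (p : ZMod n)) (i + (q : ZMod n)) →
      c ⟨s(i, i + (v : ZMod n)), h⟩ = 0 := fun p q hp hq hPp hQq he hadj =>
    eq_zero_of_separation hc he hadj ((add_natCast_mem_offsetSet hp).2 hPp)
      ((add_natCast_mem_offsetSet hq).2 hQq) h hsep hiP
      (mt (add_natCast_mem_offsetSet hv).1 hvP) hP hQ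
      ((add_natCast_mem_offsetSet han).2 ha) (hadj0 a han h0a)
      ((add_natCast_mem_offsetSet han').2 ha') ((wagner_adj_iff hn heven hv han').2 hva)
      ((add_natCast_mem_offsetSet hbn).2 hb) (hadj0 b hbn h0b)
      ((add_natCast_mem_offsetSet hbn').2 hb') ((wagner_adj_iff hn heven hv hbn').2 hvb)
  rcases hw with ⟨h1, h2⟩ | ⟨h1, h2⟩
  · exact main w w' hwn hwn' h1 h2 he hww'
  · exact main w' w hwn' hwn h2 h1 (he.trans Sym2.eq_swap) hww'.symm

lemma eq_zero_of_rim_edge [Fintype (wagner n).edgeSet] (hn : 6 ≤ n) (heven : Even n)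
    {c : (wagner n).edgeSet → ℝ} {e : Sym2 (ZMod n)}
    (hc : ∀ D, IsBond (wagner n) D → e ∈ D → dot c (indVec (wagner n) D) = 0)
    {i : ZMod n} {a b : ℕ} (ha : 2 ≤ a) (hab : a < b) (hb : b < n)
    (he : e = s(i + (a : ZMod n), i + (b : ZMod n)))
    (hadj : (wagner n).Adj (i + (a : ZMod n)) (i + (b : ZMod n)))
    (h : (wagner n).Adj i (i + ((1 : ℕ) : ZMod n))) :
    c ⟨s(i, i + ((1 : ℕ) : ZMod n)), h⟩ = 0 := by
  have hcases := (wagner_adj_iff hn heven (by omega) hb).1 hadj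
  have heven' := heven
  obtain ⟨m, hm⟩ := heven'
  by_cases h1 : b = a + 1 ∧ a ≠ m
  · by_cases h2 : a < m
    · refine eq_zero_of_offset_separation hn heven hc (P := fun k => a + 1 ≤ k ∧ k ≤ m + 1)
        (Q := fun k => (2 ≤ k ∧ k ≤ a) ∨ (m + 2 ≤ k ∧ k ≤ n - 1)) m (m + 1) (n - 1) 2 he h hadj
        (preconnected_offsetSet_Icc hn heven i (by omega))
        (preconnected_offsetSet_Icc_or_Icc hn heven i (p := 2) (q := m + 2)
          ?_ ?_ ?_ ?_ ?_) ?_ ?_ ?_ ?_ ?_ ?_ ?_ ?_ ?_ ?_ ?_ ?_ ?_ <;> omega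
    · refine eq_zero_of_offset_separation hn heven hc (P := fun k => m ≤ k ∧ k ≤ a)
        (Q := fun k => (2 ≤ k ∧ k ≤ m - 1) ∨ (a + 1 ≤ k ∧ k ≤ n - 1)) m (m + 1) (n - 1) 2
        he h hadj
        (preconnected_offsetSet_Icc hn heven i (by omega))
        (preconnected_offsetSet_Icc_or_Icc hn heven i (p := m - 1) (q := n - 1)
          ?_ ?_ ?_ ?_ ?_) ?_ ?_ ?_ ?_ ?_ ?_ ?_ ?_ ?_ ?_ ?_ ?_ ?_ <;> omega
  · refine eq_zero_of_offset_separation hn heven hc (P := fun k => 2 ≤ k ∧ k ≤ m)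
      (Q := fun k => m + 1 ≤ k ∧ k ≤ n - 1) m 2 (n - 1) (m + 1) he h hadj
      (preconnected_offsetSet_Icc hn heven i (by omega))
      (preconnected_offsetSet_Icc hn heven i (by omega))
      ?_ ?_ ?_ ?_ ?_ ?_ ?_ ?_ ?_ ?_ ?_ ?_ ?_ <;> omega

lemma eq_zero_of_spoke [Fintype (wagner n).edgeSet] (hn : 6 ≤ n) (heven : Even n)
    {c : (wagner n).edgeSet → ℝ} {e : Sym2 (ZMod n)}
    (hc : ∀ D, IsBond (wagner n) D → e ∈ D → dot c (indVec (wagner n) D) = 0)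
    {i : ZMod n} {a b : ℕ} (ha : a ≠ 0) (ha' : a ≠ n / 2) (hb' : b ≠ n / 2) (hab : a < b)
    (hb : b < n) (he : e = s(i + (a : ZMod n), i + (b : ZMod n)))
    (hadj : (wagner n).Adj (i + (a : ZMod n)) (i + (b : ZMod n)))
    (h : (wagner n).Adj i (i + ((n / 2 : ℕ) : ZMod n))) :
    c ⟨s(i, i + ((n / 2 : ℕ) : ZMod n)), h⟩ = 0 := by
  have hcases := (wagner_adj_iff hn heven (by omega) hb).1 hadj
  have heven' := heven
  obtain ⟨m, hm⟩ := heven'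
  have split : ∀ k, 1 ≤ k → k ≤ m - 2 → (a = k ∨ a = m + k) → b = a + 1 →
      c ⟨s(i, i + ((n / 2 : ℕ) : ZMod n)), h⟩ = 0 := by
    intro k hk1 hk2 hk hba
    refine eq_zero_of_offset_separation hn heven hc
      (P := fun j => (1 ≤ j ∧ j ≤ k) ∨ (m + 1 ≤ j ∧ j ≤ m + k))
      (Q := fun j => (k + 1 ≤ j ∧ j ≤ m - 1) ∨ (m + k + 1 ≤ j ∧ j ≤ n - 1))
      1 (m + 1) (n - 1) (m - 1) he h hadj
      (preconnected_offsetSet_Icc_or_Icc hn heven i (p := 1) (q := m + 1)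
        ?_ ?_ ?_ ?_ ?_)
      (preconnected_offsetSet_Icc_or_Icc hn heven i (p := m - 1) (q := n - 1)
        ?_ ?_ ?_ ?_ ?_) ?_ ?_ ?_ ?_ ?_ ?_ ?_ ?_ ?_ ?_ ?_ ?_ ?_ <;> omega
  by_cases h1 : b = a + 1
  · by_cases h2 : a < m
    · exact split a (by omega) (by omega) (by omega) h1
    · exact split (a - m) (by omega) (by omega) (by omega) h1
  · refine eq_zero_of_offset_separation hn heven hc (P := fun k => 1 ≤ k ∧ k ≤ m - 1)
      (Q := fun k => m + 1 ≤ k ∧ k ≤ n - 1) 1 (m - 1) (n - 1) (m + 1) he h hadj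
      (preconnected_offsetSet_Icc hn heven i (by omega))
      (preconnected_offsetSet_Icc hn heven i (by omega))
      ?_ ?_ ?_ ?_ ?_ ?_ ?_ ?_ ?_ ?_ ?_ ?_ ?_ <;> omega

lemma eq_zero_of_not_incident [Fintype (wagner n).edgeSet] (hn : 6 ≤ n) (heven : Even n)
    {c : (wagner n).edgeSet → ℝ} {w w' : ZMod n} (hww' : (wagner n).Adj w w')
    (hc : ∀ D, IsBond (wagner n) D → s(w, w') ∈ D → dot c (indVec (wagner n) D) = 0)
    {u v : ZMod n} (h : (wagner n).Adj u v) (huw : w ≠ u) (huw' : w' ≠ u) (hvw : w ≠ v)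
    (hvw' : w' ≠ v) : c ⟨s(u, v), h⟩ = 0 := by
  have hn0 : 0 < n := by omega
  have aux : ∀ (i : ZMod n) (v : ℕ) (hv : v = 1 ∨ v = n / 2)
      (h : (wagner n).Adj i (i + (v : ZMod n))), w ≠ i → w' ≠ i → w ≠ i + (v : ZMod n) →
      w' ≠ i + (v : ZMod n) → c ⟨s(i, i + (v : ZMod n)), h⟩ = 0 := by
    intro i v hv h h1 h2 h3 h4
    obtain ⟨p, hp, rfl⟩ := exists_offset i w
    obtain ⟨q, hq, rfl⟩ := exists_offset i w'
    have hi : i + ((0 : ℕ) : ZMod n) = i := by simp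
    have hp0 : p ≠ 0 := by rintro rfl; exact h1 hi
    have hq0 : q ≠ 0 := by rintro rfl; exact h2 hi
    have hpv : p ≠ v := by rintro rfl; exact h3 rfl
    have hqv : q ≠ v := by rintro rfl; exact h4 rfl
    have hpq : p ≠ q := by rintro rfl; exact hww'.ne rfl
    rcases hv with rfl | rfl
    · rcases lt_or_gt_of_ne hpq with hlt | hlt
      · exact eq_zero_of_rim_edge hn heven hc (by omega) hlt hq rfl hww' h
      · exact eq_zero_of_rim_edge hn heven hc (by omega) hlt hp Sym2.eq_swap hww'.symm h
    · rcases lt_or_gt_of_ne hpq with hlt | hlt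
      · exact eq_zero_of_spoke hn heven hc hp0 hpv hqv hlt hq rfl hww' h
      · exact eq_zero_of_spoke hn heven hc hq0 hqv hpv hlt hp Sym2.eq_swap hww'.symm h
  have h' := h
  simp only [wagner, SimpleGraph.fromRel_adj] at h'
  have hswap : c ⟨s(u, v), h⟩ = c ⟨s(v, u), h.symm⟩ := by
    congr 2
    exact Sym2.eq_swap
  have hfrom : ∀ {x y : ZMod n} (k : ℕ), x - y = (k : ZMod n) → x = y + (k : ZMod n) :=
    fun k hk => by rw [← hk]; abel
  rcases h'.2 with (h1 | h1) | (h1 | h1)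
  · obtain rfl := hfrom 1 (by simpa using h1)
    rw [hswap]
    exact aux v 1 (.inl rfl) h.symm hvw hvw' huw huw'
  · obtain rfl := hfrom _ h1
    rw [hswap]
    exact aux v _ (.inr rfl) h.symm hvw hvw' huw huw'
  · obtain rfl := hfrom 1 (by simpa using h1)
    exact aux u 1 (.inl rfl) h huw huw' hvw hvw'
  · obtain rfl := hfrom _ h1
    exact aux u _ (.inr rfl) h huw huw' hvw hvw'

lemma isBond_cut_singleton (hn : 6 ≤ n) (heven : Even n) (u : ZMod n) :
    IsBond (wagner n) (cut (wagner n) {u}) := by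
  refine ⟨{u}, rfl, ?_, ?_⟩
  · rintro ⟨p, rfl⟩ ⟨q, rfl⟩
    rfl
  · suffices h : ({u} : Set (ZMod n))ᶜ = offsetSet u fun k => 1 ≤ k ∧ k ≤ n - 1 by
      rw [h]
      exact preconnected_offsetSet_Icc hn heven u (by omega)
    ext x
    have := ZMod.val_lt (x - u)
    have h0 : (x - u).val = 0 ↔ x = u := by rw [ZMod.val_eq_zero, sub_eq_zero]
    change ¬(x = u) ↔ 1 ≤ (x - u).val ∧ (x - u).val ≤ n - 1
    rw [← h0]
    omega

lemma isBond_cut_pair (hn : 6 ≤ n) (heven : Even n) {u x : ZMod n} (h : (wagner n).Adj u x) :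
    IsBond (wagner n) (cut (wagner n) {u, x}) := by
  refine ⟨{u, x}, rfl, (SimpleGraph.induce_pair_connected_of_adj h).preconnected, ?_⟩
  obtain ⟨b, hb, rfl⟩ := exists_offset u x
  have hu : u + ((0 : ℕ) : ZMod n) = u := by simp
  have hcases := h
  nth_rw 1 [← hu] at hcases
  rw [wagner_adj_iff hn heven (by omega) hb] at hcases
  have hcompl : ∀ P : ℕ → Prop, (∀ k < n, P k ↔ ¬(k = 0 ∨ k = b)) →
      ({u, u + (b : ZMod n)} : Set (ZMod n))ᶜ = offsetSet u P := by
    intro P hP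
    ext y
    obtain ⟨k, hk, rfl⟩ := exists_offset u y
    have hk0 : u + (k : ZMod n) = u ↔ k = 0 := by
      rw [← add_natCast_inj (i := u) hk (by omega), hu]
    rw [add_natCast_mem_offsetSet hk, hP k hk, ← hk0, ← add_natCast_inj (i := u) hk hb]
    rfl
  have heven' := heven
  obtain ⟨m, hm⟩ := heven'
  by_cases h1 : b = 1
  · rw [hcompl (fun k => 2 ≤ k ∧ k ≤ n - 1) (by intros; omega)]
    exact preconnected_offsetSet_Icc hn heven u (by omega)
  by_cases h2 : b = n - 1
  · rw [hcompl (fun k => 1 ≤ k ∧ k ≤ n - 2) (by intros; omega)]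
    exact preconnected_offsetSet_Icc hn heven u (by omega)
  · rw [hcompl (fun k => (1 ≤ k ∧ k ≤ m - 1) ∨ (m + 1 ≤ k ∧ k ≤ n - 1)) (by intros; omega)]
    exact preconnected_offsetSet_Icc_or_Icc hn heven u (p := 1) (q := m + 1) (by omega)
      (by omega) (by omega) (by omega) (by omega)

lemma wagner_not_adj_of_adj_of_adj (hn : 6 ≤ n) (heven : Even n) {x y z : ZMod n}
    (h : (wagner n).Adj x y) (h' : (wagner n).Adj x z) : ¬(wagner n).Adj y z := by
  obtain ⟨b, hb, rfl⟩ := exists_offset x y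
  obtain ⟨d, hd, rfl⟩ := exists_offset x z
  have hx : x = x + ((0 : ℕ) : ZMod n) := by simp
  rw [hx, add_assoc, ← Nat.cast_add, wagner_adj_iff hn heven (by omega) (by omega)] at h h'
  rw [wagner_adj_iff hn heven hb hd]
  obtain ⟨m, hm⟩ := heven
  omega

lemma eq_zero_of_incident [Fintype (wagner n).edgeSet] (hn : 6 ≤ n) (heven : Even n)
    {c : (wagner n).edgeSet → ℝ} {u w : ZMod n} (huw : (wagner n).Adj u w)
    (hc : ∀ D, IsBond (wagner n) D → s(u, w) ∈ D → dot c (indVec (wagner n) D) = 0)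
    {x : ZMod n} (h : (wagner n).Adj u x) (hx : x ≠ w) : c ⟨s(u, x), h⟩ = 0 := by
  have hempty : dot c (indVec (wagner n) (cut (wagner n) ∅)) = 0 := by
    simp [dot, indVec, cut]
  have hu : dot c (indVec (wagner n) (cut (wagner n) {u})) = 0 := by
    refine hc _ (isBond_cut_singleton hn heven u) ?_
    simp [mem_cut_iff, huw, huw.ne']
  have hux : dot c (indVec (wagner n) (cut (wagner n) {u, x})) = 0 := by
    refine hc _ (isBond_cut_pair hn heven h) ?_
    simp [mem_cut_iff, huw, huw.ne', hx.symm]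
  have hstar : dot c (indVec (wagner n) (cut (wagner n) {x})) = c ⟨s(u, x), h⟩ := by
    rw [dot_indVec_eq, Finset.sum_eq_single ⟨s(u, x), h⟩]
    · simp [indVec, mem_cut_iff, h, h.ne]
    · have hzero : ∀ (y : ZMod n) (hy : (wagner n).Adj x y), y ≠ u → c ⟨s(x, y), hy⟩ = 0 := by
        intro y hy hyu
        refine eq_zero_of_not_incident hn heven huw hc hy h.ne hx.symm hyu.symm ?_
        rintro rfl
        exact wagner_not_adj_of_adj_of_adj hn heven h huw hy
      rintro ⟨g, hg⟩ - hne
      by_cases hmem : g ∈ cut (wagner n) {x}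
      · induction g using Sym2.ind with
        | _ y z =>
          have hyz := (mem_cut_iff.1 hmem).1
          by_cases hyx : y = x
          · subst hyx
            rw [hzero z hyz (by rintro rfl; simp [Sym2.eq_swap] at hne), zero_mul]
          · have hzx : z = x := by
              have := (mem_cut_iff.1 hmem).2
              simp only [Set.mem_singleton_iff] at this
              tauto
            subst hzx
            have := hzero y hyz.symm (by rintro rfl; simp at hne)
            simp only [Sym2.eq_swap (a := z)] at this
            rw [this, zero_mul]
      · simp [indVec, hmem]
    · simp
  have := dot_cut_second_difference c h (Set.notMem_empty u) (Set.notMem_empty x)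
  simp only [insert_empty_eq] at this
  linarith

end Wagner

open scoped Classical in
theorem wagner_edge_facet (n : ℕ) [NeZero n] (hn : 6 ≤ n) (heven : Even n)
    (e : ↥(wagner n).edgeSet) :
    IsFacet (bondPolytope (wagner n)) (fun f => if f = e then (1 : ℝ) else 0) 1 := by
  obtain ⟨e, he⟩ := e
  induction e using Sym2.ind with
  | _ u w =>
    have huw : (wagner n).Adj u w := he
    have hmem : s(u, w) ∈ cut (wagner n) {u} := by simp [mem_cut_iff, huw, huw.ne']
    refine isFacet_of_orthogonal_eq_zero _ ⟨_, isBond_cut_singleton hn heven u, hmem⟩ ?_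
    intro c hc
    have hc' : ∀ D, IsBond (wagner n) D → s(w, u) ∈ D → dot c (indVec (wagner n) D) = 0 := by
      rwa [Sym2.eq_swap]
    have hne : ∀ f, f ≠ ⟨s(u, w), he⟩ → c f = 0 := by
      have hu : ∀ x (h : (wagner n).Adj u x), x ≠ w → c ⟨s(u, x), h⟩ = 0 :=
        fun x h => eq_zero_of_incident hn heven huw hc h
      have hw : ∀ x (h : (wagner n).Adj w x), x ≠ u → c ⟨s(w, x), h⟩ = 0 :=
        fun x h => eq_zero_of_incident hn heven huw.symm hc' h
      have hswap : ∀ x y (h : (wagner n).Adj x y), c ⟨s(x, y), h⟩ = c ⟨s(y, x), h.symm⟩ := by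
        intro x y h
        congr 2
        exact Sym2.eq_swap
      rintro ⟨f, hf⟩ hfe
      induction f using Sym2.ind with
      | _ x y =>
        by_cases h1 : x = u
        · subst h1
          exact hu y hf (by rintro rfl; exact hfe rfl)
        by_cases h2 : x = w
        · subst h2
          exact hw y hf (by rintro rfl; exact hfe (Subtype.ext Sym2.eq_swap))
        by_cases h3 : y = u
        · subst h3
          rw [hswap x y hf]
          exact hu x _ h2
        by_cases h4 : y = w
        · subst h4
          rw [hswap x y hf]
          exact hw x _ h1
        exact eq_zero_of_not_incident hn heven huw hc hf (Ne.symm h1) (Ne.symm h2) (Ne.symm h3)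
          (Ne.symm h4)
    have hstar := hc _ (isBond_cut_singleton hn heven u) hmem
    rw [dot_indVec_eq, Finset.sum_eq_single ⟨s(u, w), he⟩
      (fun f _ hf => by rw [hne f hf, zero_mul]) (by simp)] at hstar
    simp only [indVec, hmem, if_true, mul_one] at hstar
    funext f
    by_cases hf : f = ⟨s(u, w), he⟩
    · rw [hf]
      exact hstar
    · exact hne f hf

end BondPolytope
end

section
/- For every n ≥ 3, the bond polytope BOND(W_n) of the wheel graph W_n is exactly the set of x ∈ ℝ^{E(W_n)} satisfying: x_e − x_f − x_g ≤ 0 for every triangle with edge set {e, f, g} of W_n and every choice of e among its three edges; x_e + x_f + x_g ≤ 2 for every triangle with edge set {e, f, g} of W_n; x_e − ∑_{f ∈ R, f ≠ e} x_f ≤ 0 for every rim edge e ∈ R; and ∑_{e ∈ R} x_e ≤ 2, where R is the set of rim edges of W_n. -/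
open Finset

namespace BondPolytope

variable {V : Type*}

/-- The wheel graph `W_n`: the rim is the cycle on `ZMod n` (vertices `some i`),
and the center `none` is adjacent to every rim vertex. -/
def wheel (n : ℕ) : SimpleGraph (Option (ZMod n)) :=
  SimpleGraph.fromRel (fun x y =>
    (∃ i : ZMod n, x = some i ∧ y = some (i + 1)) ∨ (x = none ∧ ∃ i : ZMod n, y = some i))

/-- The set of rim edges of the wheel graph. -/
def rimEdges (n : ℕ) : Set (Sym2 (Option (ZMod n))) :=
  {e | ∃ i : ZMod n, e = s(some i, some (i + 1))}

section Wheel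

variable {n : ℕ}

lemma indVec_cut_mk (G : SimpleGraph V) (S : Set V) {p q : V} (h : s(p, q) ∈ G.edgeSet)
    [Decidable (p ∈ S ↔ q ∈ S)] :
    indVec G (cut G S) ⟨s(p, q), h⟩ = if p ∈ S ↔ q ∈ S then 0 else 1 := by
  have key : s(p, q) ∈ cut G S ↔ ¬ (p ∈ S ↔ q ∈ S) := by
    constructor
    · rintro ⟨-, u, w, huw, hu, hw⟩
      rcases Sym2.eq_iff.1 huw with ⟨rfl, rfl⟩ | ⟨rfl, rfl⟩ <;> tauto
    · intro hne
      by_cases hp : p ∈ S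
      · exact ⟨h, p, q, rfl, hp, by tauto⟩
      · exact ⟨h, q, p, Sym2.eq_swap, by tauto, hp⟩
  unfold indVec
  by_cases hpq : p ∈ S ↔ q ∈ S <;> simp [key, hpq]

lemma cut_compl (G : SimpleGraph V) (S : Set V) : cut G Sᶜ = cut G S := by
  ext e
  constructor <;> rintro ⟨he, u, w, rfl, hu, hw⟩ <;>
    exact ⟨he, w, u, Sym2.eq_swap, by simpa using hw, by simpa using hu⟩

lemma wheel_adj_none_some (i : ZMod n) : (wheel n).Adj none (some i) := by
  simp [wheel]

lemma wheel_adj_some_succ (hn : 3 ≤ n) (i : ZMod n) :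
    (wheel n).Adj (some i) (some (i + 1)) := by
  have : Fact (1 < n) := ⟨by omega⟩
  simp [wheel]

lemma wheel_adj_some_some {i j : ZMod n} (h : (wheel n).Adj (some i) (some j)) :
    j = i + 1 ∨ i = j + 1 := by
  simpa [wheel] using h.2

/-- The spoke from the center to the rim vertex `i`. -/
def spoke (i : ZMod n) : ↥(wheel n).edgeSet :=
  ⟨s(none, some i), (wheel n).mem_edgeSet.mpr (wheel_adj_none_some i)⟩

/-- The rim edge from `i` to `i + 1`. -/
def rim (hn : 3 ≤ n) (i : ZMod n) : ↥(wheel n).edgeSet :=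
  ⟨s(some i, some (i + 1)), (wheel n).mem_edgeSet.mpr (wheel_adj_some_succ hn i)⟩

lemma eq_spoke_or_eq_rim (hn : 3 ≤ n) (e : ↥(wheel n).edgeSet) :
    (∃ i, e = spoke i) ∨ ∃ i, e = rim hn i := by
  obtain ⟨e, he⟩ := e
  induction e using Sym2.ind with
  | _ p q =>
    rcases p with _ | i <;> rcases q with _ | j
    · exact absurd he (wheel n).irrefl
    · exact Or.inl ⟨j, rfl⟩
    · exact Or.inl ⟨i, Subtype.ext Sym2.eq_swap⟩
    · rcases wheel_adj_some_some he with rfl | rfl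
      · exact Or.inr ⟨i, rfl⟩
      · exact Or.inr ⟨j, Subtype.ext Sym2.eq_swap⟩

lemma edgeVec_ext (hn : 3 ≤ n) {x x' : ↥(wheel n).edgeSet → ℝ}
    (hs : ∀ i, x (spoke i) = x' (spoke i)) (hr : ∀ i, x (rim hn i) = x' (rim hn i)) : x = x' := by
  funext e
  rcases eq_spoke_or_eq_rim hn e with ⟨i, rfl⟩ | ⟨i, rfl⟩
  exacts [hs i, hr i]

lemma rim_injective (hn : 3 ≤ n) : Function.Injective (rim hn) := by
  intro i j h
  have h2 : ((2 : ℕ) : ZMod n) ≠ 0 := by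
    rw [Ne, ZMod.natCast_eq_zero_iff]
    exact fun hd => absurd (Nat.le_of_dvd (by norm_num) hd) (by omega)
  have h' := Subtype.ext_iff.1 h
  simp only [rim, Sym2.eq_iff, Option.some.injEq] at h'
  rcases h' with ⟨h', -⟩ | ⟨rfl, h'⟩
  · exact h'
  · exact absurd (by push_cast; linear_combination h') h2

lemma rim_mem_rimEdges (hn : 3 ≤ n) (i : ZMod n) :
    (rim hn i : Sym2 (Option (ZMod n))) ∈ rimEdges n := ⟨i, rfl⟩

lemma exists_rim_of_mem (hn : 3 ≤ n) {e : ↥(wheel n).edgeSet}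
    (he : (e : Sym2 (Option (ZMod n))) ∈ rimEdges n) : ∃ i, e = rim hn i := by
  obtain ⟨i, hi⟩ := he
  exact ⟨i, Subtype.ext hi⟩

open scoped Classical in
lemma sum_rimEdges [NeZero n] (hn : 3 ≤ n) (x : ↥(wheel n).edgeSet → ℝ) :
    ∑ e ∈ Finset.univ.filter
      (fun f : ↥(wheel n).edgeSet => (f : Sym2 (Option (ZMod n))) ∈ rimEdges n), x e =
      ∑ i, x (rim hn i) := by
  symm
  refine Finset.sum_bij (fun i _ => rim hn i) ?_ ?_ ?_ ?_
  · intro i _; simp [rim_mem_rimEdges]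
  · intro i _ j _ h; exact rim_injective hn h
  · intro e he
    obtain ⟨i, rfl⟩ := exists_rim_of_mem hn (Finset.mem_filter.1 he).2
    exact ⟨i, Finset.mem_univ _, rfl⟩
  · intro i _; rfl

open scoped Classical in
lemma sum_rimEdges_ne [NeZero n] (hn : 3 ≤ n) (x : ↥(wheel n).edgeSet → ℝ) (i : ZMod n) :
    ∑ e ∈ Finset.univ.filter
      (fun f : ↥(wheel n).edgeSet =>
        (f : Sym2 (Option (ZMod n))) ∈ rimEdges n ∧ f ≠ rim hn i), x e =
      ∑ j, x (rim hn j) - x (rim hn i) := by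
  rw [← sum_rimEdges hn, ← Finset.filter_filter, Finset.filter_ne', eq_sub_iff_add_eq]
  exact Finset.sum_erase_add _ _ (by simp [rim_mem_rimEdges])

/-- An index at which the cyclic sequence of memberships in `S` leaves `S`. -/
def IsExit (S : Set (ZMod n)) (i : ZMod n) : Prop := i ∈ S ∧ i + 1 ∉ S

lemma val_sub_one [NeZero n] (hn : 3 ≤ n) {d : ZMod n} (hd : d ≠ 0) :
    (d - 1).val + 1 = d.val := by
  have : Fact (1 < n) := ⟨by omega⟩
  have hpos : 0 < d.val := ZMod.val_pos.2 hd
  rw [ZMod.val_sub (by rw [ZMod.val_one]; exact hpos), ZMod.val_one]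
  omega

lemma isExit_unique_of_preconnected [NeZero n] (hn : 3 ≤ n) {S : Set (Option (ZMod n))}
    (hS : ((wheel n).induce S).Preconnected) (h0 : none ∉ S) {i j : ZMod n}
    (hi : IsExit (some ⁻¹' S) i) (hj : IsExit (some ⁻¹' S) j) : i = j := by
  by_contra hij
  let T : Set ↥S := {v | ∃ k : ZMod n, v.1 = some k ∧ (i - k).val < (i - (j + 1)).val}
  have hstep : ∀ u v : ↥S, ((wheel n).induce S).Adj u v → u ∈ T → v ∈ T := by
    rintro ⟨u, hu⟩ ⟨v, hv⟩ hadj ⟨k, rfl, hk⟩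
    rcases v with _ | l
    · exact absurd hv h0
    refine ⟨l, rfl, ?_⟩
    rcases wheel_adj_some_some hadj with rfl | rfl
    · have hne : i - k ≠ 0 := by
        intro h
        rw [sub_eq_zero] at h
        subst h
        exact hi.2 hv
      have := val_sub_one hn hne
      rw [show i - (k + 1) = i - k - 1 by ring]
      omega
    · have hne : i - l ≠ 0 := by
        intro h
        rw [sub_eq_zero] at h
        subst h
        exact hi.2 hu
      have h1 := val_sub_one hn hne
      rw [show i - l - 1 = i - (l + 1) by ring] at h1
      have hne' : (i - l).val ≠ (i - (j + 1)).val := by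
        intro h
        have h := ZMod.val_injective n h
        have : l = j + 1 := by linear_combination -h
        subst this
        exact hj.2 hv
      omega
  have hreach : ∀ u v : ↥S, ((wheel n).induce S).Reachable u v → u ∈ T → v ∈ T := by
    rintro u v ⟨w⟩
    induction w with
    | nil => exact id
    | cons h _ ih => exact fun hu => ih (hstep _ _ h hu)
  have hiT : (⟨some i, hi.1⟩ : ↥S) ∈ T := by
    refine ⟨i, rfl, ?_⟩
    have hne : i - (j + 1) ≠ 0 := by
      intro h
      rw [sub_eq_zero] at h
      subst h
      exact hj.2 hi.1
    simpa using ZMod.val_pos.2 hne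
  obtain ⟨k, hk, hlt⟩ := hreach _ ⟨some j, hj.1⟩ (hS _ _) hiT
  obtain rfl : j = k := Option.some.inj hk
  have := val_sub_one hn (sub_ne_zero.2 hij)
  rw [show i - j - 1 = i - (j + 1) by ring] at this
  omega

lemma preconnected_of_isExit_unique [NeZero n] (hn : 3 ≤ n) {S : Set (ZMod n)}
    (hS : ∀ i j, IsExit S i → IsExit S j → i = j) :
    ((wheel n).induce (some '' S)).Preconnected := by
  have main : ∀ k (hk : k ∈ S),
      (∃ m, ∃ hm : IsExit S m, ((wheel n).induce (some '' S)).Reachable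
        ⟨some k, k, hk, rfl⟩ ⟨some m, m, hm.1, rfl⟩) ∨
      ∀ l, ∃ hl : l ∈ S, ((wheel n).induce (some '' S)).Reachable
        ⟨some k, k, hk, rfl⟩ ⟨some l, l, hl, rfl⟩ := by
    intro k hk
    by_contra! hcon
    obtain ⟨hexit, l, hl⟩ := hcon
    have walk : ∀ t : ℕ, ∃ ht : k + t ∈ S, ((wheel n).induce (some '' S)).Reachable
        ⟨some k, k, hk, rfl⟩ ⟨some (k + t), k + t, ht, rfl⟩ := by
      intro t
      induction t with
      | zero => simp [hk]
      | succ t ih =>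
        obtain ⟨ht, hr⟩ := ih
        have hmem : k + (t : ZMod n) + 1 ∈ S := by
          by_contra hnot
          exact hexit _ ⟨ht, hnot⟩ hr
        have hadj : ((wheel n).induce (some '' S)).Adj ⟨some (k + t), k + t, ht, rfl⟩
            ⟨some (k + t + 1), k + t + 1, hmem, rfl⟩ := wheel_adj_some_succ hn _
        have heq : k + ((t + 1 : ℕ) : ZMod n) = k + t + 1 := by push_cast; ring
        simp only [heq]
        exact ⟨hmem, hr.trans hadj.reachable⟩
    obtain ⟨h1, h2⟩ := walk (l - k).val
    have heq : k + ((l - k).val : ZMod n) = l := by simp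
    simp only [heq] at h1 h2
    exact hl h1 h2
  rintro ⟨_, k, hk, rfl⟩ ⟨_, l, hl, rfl⟩
  rcases main k hk with ⟨m, hm, h1⟩ | h
  · rcases main l hl with ⟨m', hm', h2⟩ | h
    · obtain rfl := hS _ _ hm hm'
      exact h1.trans h2.symm
    · exact (h k).2.symm
  · exact (h l).2

lemma preconnected_of_none_mem {S : Set (Option (ZMod n))} (h0 : none ∈ S) :
    ((wheel n).induce S).Preconnected := by
  have key : ∀ v : ↥S, ((wheel n).induce S).Reachable ⟨none, h0⟩ v := by
    rintro ⟨_ | i, hv⟩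
    · rfl
    · exact SimpleGraph.Adj.reachable (wheel_adj_none_some i)
  exact fun u v => (key u).symm.trans (key v)

/-- The indicator vector of the cut around the rim vertices in `S`. -/
noncomputable def rimVec (S : Set (ZMod n)) : ↥(wheel n).edgeSet → ℝ :=
  indVec (wheel n) (cut (wheel n) (some '' S))

open scoped Classical in
lemma rimVec_spoke (S : Set (ZMod n)) (i : ZMod n) :
    rimVec S (spoke i) = if i ∈ S then 1 else 0 := by
  exact (indVec_cut_mk _ _ _).trans (by simp)

open scoped Classical in
lemma rimVec_rim (hn : 3 ≤ n) (S : Set (ZMod n)) (i : ZMod n) :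
    rimVec S (rim hn i) = if i ∈ S ↔ i + 1 ∈ S then 0 else 1 := by
  exact (indVec_cut_mk _ _ _).trans (by simp)

lemma rimVec_mem_bondPolytope [NeZero n] (hn : 3 ≤ n) {S : Set (ZMod n)}
    (hS : ∀ i j, IsExit S i → IsExit S j → i = j) : rimVec S ∈ bondPolytope (wheel n) :=
  subset_convexHull ℝ _ ⟨_, ⟨_, rfl, preconnected_of_isExit_unique hn hS,
    preconnected_of_none_mem (by simp)⟩, rfl⟩

lemma exists_rimVec_of_isBond [NeZero n] (hn : 3 ≤ n) {D : Set (Sym2 (Option (ZMod n)))}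
    (hD : IsBond (wheel n) D) :
    ∃ S : Set (ZMod n), indVec (wheel n) D = rimVec S ∧
      ∀ i j, IsExit S i → IsExit S j → i = j := by
  have key : ∀ S : Set (Option (ZMod n)), none ∉ S → ((wheel n).induce S).Preconnected →
      ∃ R : Set (ZMod n), indVec (wheel n) (cut (wheel n) S) = rimVec R ∧
        ∀ i j, IsExit R i → IsExit R j → i = j := by
    intro S h0 hS
    refine ⟨some ⁻¹' S, ?_, fun i j => isExit_unique_of_preconnected hn hS h0⟩
    have : some '' (some ⁻¹' S) = S := by
      rw [Set.image_preimage_eq_iff]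
      rintro (_ | i) hv
      · exact absurd hv h0
      · exact ⟨i, rfl⟩
    rw [rimVec, this]
  obtain ⟨S, rfl, h1, h2⟩ := hD
  by_cases h0 : none ∈ S
  · rw [← cut_compl]
    exact key _ (by simpa using h0) h2
  · exact key S h0 h1

lemma indVec_cut_triangle (G : SimpleGraph V) (S : Set V) {p q r : V}
    (h1 : s(p, q) ∈ G.edgeSet) (h2 : s(q, r) ∈ G.edgeSet) (h3 : s(p, r) ∈ G.edgeSet) :
    indVec G (cut G S) ⟨s(p, q), h1⟩ - indVec G (cut G S) ⟨s(q, r), h2⟩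
        - indVec G (cut G S) ⟨s(p, r), h3⟩ ≤ 0 ∧
      indVec G (cut G S) ⟨s(p, q), h1⟩ + indVec G (cut G S) ⟨s(q, r), h2⟩
        + indVec G (cut G S) ⟨s(p, r), h3⟩ ≤ 2 := by
  classical
  simp only [indVec_cut_mk]
  by_cases hp : p ∈ S <;> by_cases hq : q ∈ S <;> by_cases hr : r ∈ S <;>
    norm_num [hp, hq, hr]

lemma sum_succ_sub [NeZero n] (t : ZMod n → ℝ) : ∑ i, (t (i + 1) - t i) = 0 := by
  rw [Finset.sum_sub_distrib, sub_eq_zero]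
  exact Equiv.sum_comp (Equiv.addRight (1 : ZMod n)) t

lemma rimVec_rim_le [NeZero n] (hn : 3 ≤ n) (S : Set (ZMod n)) (i : ZMod n) :
    rimVec S (rim hn i) ≤ ∑ j, rimVec S (rim hn j) - rimVec S (rim hn i) := by
  classical
  let t : ZMod n → ℝ := fun i => if i ∈ S then 1 else 0
  have habs : ∀ j, rimVec S (rim hn j) = |t (j + 1) - t j| := by
    intro j
    rw [rimVec_rim]
    by_cases h1 : j ∈ S <;> by_cases h2 : j + 1 ∈ S <;> simp [t, h1, h2]
  have hsum := sum_succ_sub t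
  rw [← Finset.add_sum_erase _ _ (Finset.mem_univ i)] at hsum ⊢
  simp only [habs]
  have := Finset.abs_sum_le_sum_abs (fun j => t (j + 1) - t j) (Finset.univ.erase i)
  rw [eq_neg_of_add_eq_zero_left hsum, abs_neg]
  linarith

lemma sum_rimVec_rim_le_two [NeZero n] (hn : 3 ≤ n) {S : Set (ZMod n)}
    (hS : ∀ i j, IsExit S i → IsExit S j → i = j) : ∑ i, rimVec S (rim hn i) ≤ 2 := by
  classical
  let t : ZMod n → ℝ := fun i => if i ∈ S then 1 else 0
  have h : ∀ i, rimVec S (rim hn i) = 2 * (if IsExit S i then 1 else 0) + (t (i + 1) - t i) := by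
    intro i
    rw [rimVec_rim]
    by_cases h1 : i ∈ S <;> by_cases h2 : i + 1 ∈ S <;> norm_num [t, IsExit, h1, h2]
  have hcard : (Finset.univ.filter (IsExit S)).card ≤ 1 :=
    Finset.card_le_one.2 fun i hi j hj =>
      hS i j (Finset.mem_filter.1 hi).2 (Finset.mem_filter.1 hj).2
  simp only [h]
  rw [Finset.sum_add_distrib, sum_succ_sub, ← Finset.mul_sum, Finset.sum_boole]
  have : ((Finset.univ.filter (IsExit S)).card : ℝ) ≤ 1 := by exact_mod_cast hcard
  linarith

lemma sum_zmod_eq_sum_range [NeZero n] (f : ZMod n → ℝ) :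
    ∑ i, f i = ∑ k ∈ Finset.range n, f k :=
  Finset.sum_bij' (fun i _ => i.val) (fun k _ => (k : ZMod n))
    (fun i _ => Finset.mem_range.2 i.val_lt) (fun _ _ => Finset.mem_univ _)
    (fun i _ => by simp) (fun k hk => ZMod.val_cast_of_lt (Finset.mem_range.1 hk))
    (fun i _ => by simp)

/-- Partial sums of `a` along the rim, starting from vertex `0`. -/
noncomputable def partialSum (a : ZMod n → ℝ) (i : ZMod n) : ℝ :=
  ∑ k ∈ Finset.range i.val, a k

lemma partialSum_nonneg {a : ZMod n → ℝ} (ha : ∀ i, 0 ≤ a i) (i : ZMod n) :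
    0 ≤ partialSum a i := Finset.sum_nonneg fun _ _ => ha _

lemma partialSum_add_self [NeZero n] (a : ZMod n → ℝ) (i : ZMod n) :
    partialSum a i + a i = ∑ k ∈ Finset.range (i.val + 1), a k := by
  rw [Finset.sum_range_succ, partialSum, ZMod.natCast_rightInverse i]

lemma partialSum_add_le [NeZero n] {a : ZMod n → ℝ} (ha : ∀ i, 0 ≤ a i) {i j : ZMod n}
    (hij : i.val < j.val) : partialSum a i + a i ≤ partialSum a j := by
  rw [partialSum_add_self]
  exact Finset.sum_le_sum_of_subset_of_nonneg (Finset.range_mono hij) fun _ _ _ => ha _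

lemma partialSum_add_le_sum [NeZero n] {a : ZMod n → ℝ} (ha : ∀ i, 0 ≤ a i) (i : ZMod n) :
    partialSum a i + a i ≤ ∑ j, a j := by
  rw [partialSum_add_self, sum_zmod_eq_sum_range]
  exact Finset.sum_le_sum_of_subset_of_nonneg (Finset.range_mono i.val_lt) fun _ _ _ => ha _

lemma partialSum_succ [NeZero n] (a : ZMod n → ℝ) (i : ZMod n) :
    partialSum a (i + 1) = partialSum a i + a i ∨
      partialSum a (i + 1) = partialSum a i + a i - ∑ j, a j := by
  rcases lt_or_eq_of_le (Nat.succ_le_of_lt i.val_lt) with h | h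
  · left
    have : (i + 1).val = i.val + 1 := by
      have : ((i.val + 1 : ℕ) : ZMod n) = i + 1 := by simp
      rw [← this, ZMod.val_cast_of_lt h]
    rw [partialSum_add_self, partialSum, this]
  · right
    have : i + 1 = 0 := by
      have h' : ((i.val + 1 : ℕ) : ZMod n) = i + 1 := by simp
      rw [← h', ← Nat.succ_eq_add_one, h, ZMod.natCast_self]
    rw [partialSum_add_self, sum_zmod_eq_sum_range, ← Nat.succ_eq_add_one, h, this]
    simp [partialSum]

lemma fract_sub_lt_iff {w a b y : ℝ} (ha : 0 ≤ a) (hay : a ≤ y) (hyb : y + b ≤ 1)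
    (hb : 0 ≤ b) :
    Int.fract (w - a) < y - a + b ↔ a ≤ Int.fract w ∧ Int.fract w < y + b := by
  have h0 := Int.fract_nonneg w
  have h1 := Int.fract_lt_one w
  have hw := Int.fract_add_floor w
  rcases le_or_gt a (Int.fract w) with h | h
  · have : Int.fract (w - a) = Int.fract w - a :=
      Int.fract_eq_iff.2 ⟨by linarith, by linarith, ⌊w⌋, by linarith⟩
    rw [this]
    exact ⟨fun h' => ⟨h, by linarith⟩, fun h' => by linarith [h'.2]⟩
  · have : Int.fract (w - a) = Int.fract w - a + 1 :=
      Int.fract_eq_iff.2 ⟨by linarith, by linarith, ⌊w⌋ - 1, by push_cast; linarith⟩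
    rw [this]
    exact ⟨fun h' => by linarith, fun h' => by linarith [h'.1]⟩

/-- The rim vertices whose rotating interval `[partialSum a i, partialSum a i + y i)`
contains `u` modulo `1`. -/
def arcAt (y a : ZMod n → ℝ) (u : ℝ) : Set (ZMod n) :=
  {i | Int.fract (u - partialSum a i) < y i}

lemma succ_mem_arcAt [NeZero n] {y a b : ZMod n → ℝ} (ha : ∀ i, 0 ≤ a i)
    (hb : ∀ i, 0 ≤ b i) (hay : ∀ i, a i ≤ y i) (hyb : ∀ i, y i + b i ≤ 1)
    (hy : ∀ i, y (i + 1) = y i - a i + b i) (hsum : ∑ i, a i = 1) (u : ℝ) (i : ZMod n) :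
    i + 1 ∈ arcAt y a u ↔ a i ≤ Int.fract (u - partialSum a i) ∧
      Int.fract (u - partialSum a i) < y i + b i := by
  have hfr : Int.fract (u - partialSum a (i + 1)) = Int.fract (u - partialSum a i - a i) := by
    rcases partialSum_succ a i with h | h
    · rw [h, sub_sub]
    · rw [h, hsum, ← Int.fract_add_one (u - partialSum a i - a i)]
      congr 1
      ring
  rw [arcAt, Set.mem_ofPred_eq, hfr, hy]
  exact fract_sub_lt_iff (ha i) (hay i) (hyb i) (hb i)

lemma isExit_arcAt_unique [NeZero n] {y a b : ZMod n → ℝ} (ha : ∀ i, 0 ≤ a i)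
    (hb : ∀ i, 0 ≤ b i) (hay : ∀ i, a i ≤ y i) (hyb : ∀ i, y i + b i ≤ 1)
    (hy : ∀ i, y (i + 1) = y i - a i + b i) (hsum : ∑ i, a i = 1) (u : ℝ) :
    ∀ i j, IsExit (arcAt y a u) i → IsExit (arcAt y a u) j → i = j := by
  have hlt : ∀ i, IsExit (arcAt y a u) i → Int.fract (u - partialSum a i) < a i := by
    rintro i ⟨h1, h2⟩
    rw [succ_mem_arcAt ha hb hay hyb hy hsum] at h2
    by_contra! hcon
    exact h2 ⟨hcon, lt_of_lt_of_le h1 (by linarith [hb i])⟩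
  have key : ∀ i j, IsExit (arcAt y a u) i → IsExit (arcAt y a u) j → ¬ i.val < j.val := by
    intro i j hi hj hij
    have h1 := hlt i hi
    have h2 := hlt j hj
    have h3 := partialSum_add_le ha hij
    have h4 := partialSum_nonneg ha i
    have h5 := partialSum_add_le_sum ha j
    have h6 := Int.fract_nonneg (u - partialSum a i)
    have h7 := Int.fract_nonneg (u - partialSum a j)
    have h8 := Int.fract_add_floor (u - partialSum a i)
    have h9 := Int.fract_add_floor (u - partialSum a j)
    have hfl : ⌊u - partialSum a i⌋ = ⌊u - partialSum a j⌋ := by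
      have hA : ((⌊u - partialSum a i⌋ : ℤ) : ℝ) < (⌊u - partialSum a j⌋ + 1 : ℤ) := by
        push_cast; linarith [ha i]
      have hB : ((⌊u - partialSum a j⌋ : ℤ) : ℝ) < (⌊u - partialSum a i⌋ + 1 : ℤ) := by
        push_cast; linarith [ha i]
      have hA := Int.cast_lt.1 hA
      have hB := Int.cast_lt.1 hB
      omega
    rw [hfl] at h8
    linarith
  intro i j hi hj
  exact ZMod.val_injective n
    (le_antisymm (not_lt.1 (key j i hj hi)) (not_lt.1 (key i j hi hj)))

lemma integrableOn_fract_lt (c t : ℝ) :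
    MeasureTheory.IntegrableOn (fun u : ℝ => if Int.fract (u - c) < t then (1 : ℝ) else 0)
      (Set.Ioc 0 1) := by
  have hm : Measurable fun u : ℝ => if Int.fract (u - c) < t then (1 : ℝ) else 0 :=
    Measurable.ite (measurableSet_lt (measurable_fract.comp (measurable_id.sub_const c))
      measurable_const) measurable_const measurable_const
  refine MeasureTheory.Measure.integrableOn_of_bounded (M := 1) (by simp)
    hm.aestronglyMeasurable (Filter.Eventually.of_forall fun u => ?_)
  split_ifs <;> simp

lemma integral_fract_lt (c : ℝ) {t : ℝ} (h0 : 0 ≤ t) (h1 : t ≤ 1) :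
    ∫ u in Set.Ioc (0 : ℝ) 1, (if Int.fract (u - c) < t then (1 : ℝ) else 0) = t := by
  let g : ℝ → ℝ := fun u => if Int.fract u < t then 1 else 0
  have hper : Function.Periodic g 1 := fun u => by simp [g]
  rw [← intervalIntegral.integral_of_le zero_le_one,
    intervalIntegral.integral_comp_sub_right g c,
    show (1 : ℝ) - c = 0 - c + 1 by ring, hper.intervalIntegral_add_eq (0 - c) 0, zero_add,
    intervalIntegral.integral_of_le zero_le_one, MeasureTheory.integral_Ioc_eq_integral_Ioo,
    ← MeasureTheory.integral_Ico_eq_integral_Ioo]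
  have hEq : Set.EqOn g ((Set.Iio t).indicator 1) (Set.Ico 0 1) := by
    intro u hu
    simp [g, Set.indicator, Int.fract_eq_self.2 hu]
  rw [MeasureTheory.setIntegral_congr_fun measurableSet_Ico hEq,
    MeasureTheory.setIntegral_indicator measurableSet_Iio]
  have : Set.Ico (0 : ℝ) 1 ∩ Set.Iio t = Set.Ico 0 t := by
    ext u
    simp only [Set.mem_inter_iff, Set.mem_Ico, Set.mem_Iio]
    exact ⟨fun h => ⟨h.1.1, h.2⟩, fun h => ⟨⟨h.1, by linarith [h.2]⟩, h.2⟩⟩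
  simp [this, h0]

lemma isClosed_bondPolytope [NeZero n] : IsClosed (bondPolytope (wheel n)) := by
  refine ((Set.finite_range (indVec (wheel n))).subset ?_).isCompact_convexHull ℝ |>.isClosed
  rintro _ ⟨D, -, rfl⟩
  exact ⟨D, rfl⟩

lemma mem_bondPolytope_of_sum_eq_one [NeZero n] (hn : 3 ≤ n) {y a b : ZMod n → ℝ}
    (ha : ∀ i, 0 ≤ a i) (hb : ∀ i, 0 ≤ b i) (hay : ∀ i, a i ≤ y i)
    (hyb : ∀ i, y i + b i ≤ 1) (hy : ∀ i, y (i + 1) = y i - a i + b i) (hsum : ∑ i, a i = 1)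
    {x : ↥(wheel n).edgeSet → ℝ} (hs : ∀ i, x (spoke i) = y i)
    (hr : ∀ i, x (rim hn i) = a i + b i) : x ∈ bondPolytope (wheel n) := by
  classical
  let μ : MeasureTheory.Measure ℝ := MeasureTheory.volume.restrict (Set.Ioc 0 1)
  have : MeasureTheory.IsProbabilityMeasure μ := ⟨by simp [μ]⟩
  let g : ℝ → ℝ → ℝ → ℝ := fun c t u => if Int.fract (u - c) < t then 1 else 0
  have hg : ∀ c t, MeasureTheory.Integrable (g c t) μ := integrableOn_fract_lt
  have hspoke : ∀ i, (fun u => rimVec (arcAt y a u) (spoke i)) = g (partialSum a i) (y i) :=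
    fun i => funext fun u => rimVec_spoke _ _
  have hrim : ∀ i, (fun u => rimVec (arcAt y a u) (rim hn i)) =
      g (partialSum a i) (a i) + g (partialSum a i) (y i + b i) - g (partialSum a i) (y i) := by
    intro i
    funext u
    rw [rimVec_rim, succ_mem_arcAt ha hb hay hyb hy hsum]
    simp only [arcAt, Set.mem_ofPred_eq, g, Pi.add_apply, Pi.sub_apply]
    have h1 := hay i
    have h2 := hb i
    by_cases hfa : Int.fract (u - partialSum a i) < a i
    · simp [hfa, hfa.trans_le h1, (hfa.trans_le h1).trans_le (le_add_of_nonneg_right h2)]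
    · by_cases hfy : Int.fract (u - partialSum a i) < y i
      · simp [hfa, hfy, hfy.trans_le (le_add_of_nonneg_right h2), not_lt.1 hfa]
      · by_cases hfb : Int.fract (u - partialSum a i) < y i + b i <;>
          simp [hfa, hfy, hfb, not_lt.1 hfa]
  have hint : ∀ e, MeasureTheory.Integrable (fun u => rimVec (arcAt y a u) e) μ := by
    intro e
    rcases eq_spoke_or_eq_rim hn e with ⟨i, rfl⟩ | ⟨i, rfl⟩
    · rw [hspoke]; exact hg _ _
    · rw [hrim]; exact ((hg _ _).add (hg _ _)).sub (hg _ _)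
  have hmem : ∫ u, rimVec (arcAt y a u) ∂μ ∈ bondPolytope (wheel n) :=
    (convex_convexHull ℝ _).integral_mem isClosed_bondPolytope
      (Filter.Eventually.of_forall fun u => rimVec_mem_bondPolytope hn
        (isExit_arcAt_unique ha hb hay hyb hy hsum u))
      (MeasureTheory.Integrable.of_eval hint)
  have hval : ∀ c t, 0 ≤ t → t ≤ 1 → ∫ u, g c t u ∂μ = t := fun c t h0 h1 =>
    integral_fract_lt c h0 h1
  convert hmem using 1
  refine edgeVec_ext hn (fun i => ?_) (fun i => ?_)
  · rw [MeasureTheory.eval_integral hint, hspoke, hs, hval]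
    · linarith [ha i, hay i]
    · linarith [hb i, hyb i]
  · rw [MeasureTheory.eval_integral hint, hrim, hr,
      MeasureTheory.integral_sub' ((hg _ _).add (hg _ _)) (hg _ _),
      MeasureTheory.integral_add' (hg _ _) (hg _ _), hval, hval, hval]
    all_goals linarith [ha i, hay i, hb i, hyb i]

lemma abs_sub_le_sum_Ico {f g : ℕ → ℝ} (h : ∀ k, |f (k + 1) - f k| ≤ g k) {p q : ℕ}
    (hpq : p ≤ q) : |f q - f p| ≤ ∑ k ∈ Finset.Ico p q, g k := by
  rw [← Finset.sum_Ico_sub f hpq]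
  exact (Finset.abs_sum_le_sum_abs _ _).trans (Finset.sum_le_sum fun k _ => h k)

lemma add_sub_add_le_sum [NeZero n] {y z : ZMod n → ℝ} (h : ∀ i, |y (i + 1) - y i| ≤ z i)
    {i j : ZMod n} (hij : i ≠ j) :
    (y j + y (j + 1)) - (y i + y (i + 1)) ≤ ∑ k, z k - z i - z j := by
  let f : ℕ → ℝ := fun k => y (i + k)
  let g : ℕ → ℝ := fun k => z (i + k)
  let m := (j - i).val
  have hm0 : 0 < m := ZMod.val_pos.2 (sub_ne_zero.2 hij.symm)
  have hmn : m < n := ZMod.val_lt _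
  have hmj : i + (m : ZMod n) = j := by simp [m]
  have hfg : ∀ k, |f (k + 1) - f k| ≤ g k := by
    intro k
    simpa [f, g, add_assoc] using h (i + k)
  have h1 := (abs_le.1 (abs_sub_le_sum_Ico hfg (show 1 ≤ m from hm0))).2
  have h2 := (abs_le.1 (abs_sub_le_sum_Ico hfg (show m + 1 ≤ n from hmn))).1
  have hsum : ∑ k, z k = g 0 + ∑ k ∈ Finset.Ico 1 m, g k + g m
      + ∑ k ∈ Finset.Ico (m + 1) n, g k := by
    have : ∑ k, z k = ∑ k ∈ Finset.range n, g k :=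
      (Equiv.sum_comp (Equiv.addLeft i) z).symm.trans (sum_zmod_eq_sum_range _)
    rw [this, ← Finset.sum_range_add_sum_Ico g (show m + 1 ≤ n from hmn),
      Finset.sum_range_succ, Finset.range_eq_Ico, Finset.sum_eq_sum_Ico_succ_bot hm0]
  have e0 : g 0 = z i := by simp [g]
  have em : g m = z j := by simp [g, hmj]
  have f1 : f 1 = y (i + 1) := by simp [f]
  have fm : f m = y j := by simp [f, hmj]
  have fm1 : f (m + 1) = y (j + 1) := by simp [f, ← add_assoc, hmj]
  have fn : f n = y i := by simp [f]
  rw [hsum, e0, em]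
  rw [f1, fm] at h1
  rw [fm1, fn] at h2
  linarith

lemma rimVec_empty_eq_zero (hn : 3 ≤ n) : rimVec (∅ : Set (ZMod n)) = 0 := by
  classical
  refine edgeVec_ext hn (fun i => ?_) (fun i => ?_)
  · simp [rimVec_spoke]
  · simp [rimVec_rim]

lemma zero_mem_bondPolytope [NeZero n] (hn : 3 ≤ n) : 0 ∈ bondPolytope (wheel n) := by
  rw [← rimVec_empty_eq_zero hn]
  exact rimVec_mem_bondPolytope hn fun i j hi _ => absurd hi.1 (by simp)

lemma rimVec_univ_mem_bondPolytope [NeZero n] (hn : 3 ≤ n) :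
    rimVec (Set.univ : Set (ZMod n)) ∈ bondPolytope (wheel n) :=
  rimVec_mem_bondPolytope hn fun i j hi _ => absurd hi.2 (by simp)

lemma Convex.smul_add_smul_mem_of_zero_mem {E : Type*} [AddCommGroup E] [Module ℝ E]
    {s : Set E} (hs : Convex ℝ s) (h0 : 0 ∈ s) {u v : E} (hu : u ∈ s) (hv : v ∈ s) {α β : ℝ}
    (hα : 0 ≤ α) (hβ : 0 ≤ β) (hαβ : α + β ≤ 1) : α • u + β • v ∈ s := by
  rcases eq_or_lt_of_le (add_nonneg hα hβ) with h | h
  · obtain rfl : α = 0 := by linarith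
    obtain rfl : β = 0 := by linarith
    simpa using h0
  · have := hs.smul_mem_of_zero_mem h0
      (hs hu hv (div_nonneg hα h.le) (div_nonneg hβ h.le) (by field_simp)) ⟨h.le, hαβ⟩
    rwa [smul_add, smul_smul, smul_smul, mul_div_cancel₀ _ h.ne', mul_div_cancel₀ _ h.ne'] at this

lemma mem_bondPolytope_of_inequalities [NeZero n] (hn : 3 ≤ n) {x : ↥(wheel n).edgeSet → ℝ}
    (h1 : ∀ i, |x (spoke (i + 1)) - x (spoke i)| ≤ x (rim hn i))
    (h2 : ∀ i, x (rim hn i) ≤ x (spoke i) + x (spoke (i + 1)))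
    (h3 : ∀ i, x (spoke i) + x (spoke (i + 1)) + x (rim hn i) ≤ 2)
    (h4 : ∀ i, x (rim hn i) ≤ ∑ j, x (rim hn j) - x (rim hn i))
    (h5 : ∑ i, x (rim hn i) ≤ 2) : x ∈ bondPolytope (wheel n) := by
  classical
  set y : ZMod n → ℝ := fun i => x (spoke i) with hy
  set z : ZMod n → ℝ := fun i => x (rim hn i) with hz
  set A : ℝ := (∑ i, z i) / 2 with hA
  -- `p i` and `q i` are the probabilities that `i`, `i + 1` are both inside or both outside
  let p : ZMod n → ℝ := fun i => (y i + y (i + 1) - z i) / 2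
  let q : ZMod n → ℝ := fun i => (2 - y i - y (i + 1) - z i) / 2
  have hpq : ∀ i j, 1 - A - q j ≤ p i := by
    intro i j
    by_cases hij : i = j
    · subst hij
      have := h4 i
      simp only [p, q, hA]
      linarith
    · have := add_sub_add_le_sum (y := y) (z := z) h1 hij
      simp only [p, q, hA]
      linarith
  obtain ⟨j₀, -, hj₀⟩ := Finset.exists_max_image Finset.univ (fun j => 1 - A - q j)
    Finset.univ_nonempty
  obtain ⟨l, hl0, hl1, hlp, hlq⟩ : ∃ l : ℝ, 0 ≤ l ∧ l ≤ 1 - A ∧ (∀ i, l ≤ p i) ∧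
      ∀ j, 1 - A - q j ≤ l := by
    refine ⟨max 0 (1 - A - q j₀), le_max_left _ _, max_le ?_ ?_, fun i => max_le ?_ (hpq i j₀),
      fun j => (hj₀ j (Finset.mem_univ _)).trans (le_max_right _ _)⟩
    · linarith
    · have := h3 j₀
      simp only [q]
      linarith
    · have := h2 i
      simp only [p]
      linarith
  simp only [p, q] at hlp hlq
  have habs := fun i => abs_le.1 (h1 i)
  have hz0 : ∀ i, 0 ≤ z i := fun i => (abs_nonneg _).trans (h1 i)
  have hA0 : 0 ≤ A := div_nonneg (Finset.sum_nonneg fun i _ => hz0 i) zero_le_two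
  have hus : ∀ i : ZMod n, rimVec Set.univ (spoke i) = 1 := fun i => by simp [rimVec_spoke]
  have hur : ∀ i : ZMod n, rimVec Set.univ (rim hn i) = 0 := fun i => by simp [rimVec_rim]
  rcases hA0.eq_or_lt with hA' | hA'
  · have hz' : ∀ i, z i = 0 := fun i =>
      (Finset.sum_eq_zero_iff_of_nonneg fun i _ => hz0 i).1 (by linarith) i (Finset.mem_univ i)
    have hx : x = l • rimVec Set.univ := by
      refine edgeVec_ext hn (fun i => ?_) (fun i => ?_)
      · have ha := habs i
        have hb := hlp i
        have hc := hlq i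
        have hd := hz' i
        simp only [hy, hz] at hb hc hd
        rw [Pi.smul_apply, hus, smul_eq_mul, mul_one]
        linarith
      · rw [Pi.smul_apply, hur, smul_zero]
        exact hz' i
    rw [hx]
    exact (convex_convexHull ℝ _).smul_mem_of_zero_mem (zero_mem_bondPolytope hn)
      (rimVec_univ_mem_bondPolytope hn) ⟨hl0, by linarith⟩
  · have hx : x = l • rimVec Set.univ + A • (A⁻¹ • (x - l • rimVec Set.univ)) := by
      rw [smul_inv_smul₀ hA'.ne']
      simp
    rw [hx]
    refine Convex.smul_add_smul_mem_of_zero_mem (convex_convexHull ℝ _)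
      (zero_mem_bondPolytope hn) (rimVec_univ_mem_bondPolytope hn) ?_ hl0 hA0 (by linarith)
    have hinv : 0 < A⁻¹ := inv_pos.2 hA'
    refine mem_bondPolytope_of_sum_eq_one hn (y := fun i => A⁻¹ * (y i - l))
      (a := fun i => A⁻¹ * ((y i - y (i + 1) + z i) / 2))
      (b := fun i => A⁻¹ * ((y (i + 1) - y i + z i) / 2)) ?_ ?_ ?_ ?_ ?_ ?_ ?_ ?_
    · exact fun i => mul_nonneg hinv.le (by linarith [(habs i).2])
    · exact fun i => mul_nonneg hinv.le (by linarith [(habs i).1])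
    · exact fun i => mul_le_mul_of_nonneg_left (by linarith [hlp i]) hinv.le
    · intro i
      rw [← mul_add, inv_mul_le_iff₀ hA']
      linarith [hlq i]
    · intro i
      ring
    · rw [← Finset.mul_sum, ← Finset.sum_div, Finset.sum_add_distrib]
      have : ∑ i, (y i - y (i + 1)) = 0 := by
        rw [← neg_eq_zero, ← Finset.sum_neg_distrib, ← sum_succ_sub y]
        simp
      rw [this, zero_add, inv_mul_cancel₀ hA'.ne']
    · intro i
      simp [hus, hy]
    · intro i
      simp only [Pi.smul_apply, Pi.sub_apply, hur, smul_eq_mul, hz]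
      ring

end Wheel

open scoped Classical in
theorem bondPolytope_wheel_description (n : ℕ) [NeZero n] (hn : 3 ≤ n) :
    bondPolytope (wheel n) =
      {x : ↥(wheel n).edgeSet → ℝ |
        (∀ p q r : Option (ZMod n), ∀ (h1 : (wheel n).Adj p q) (h2 : (wheel n).Adj q r)
            (h3 : (wheel n).Adj p r),
          (x ⟨s(p, q), (wheel n).mem_edgeSet.mpr h1⟩
              - x ⟨s(q, r), (wheel n).mem_edgeSet.mpr h2⟩
              - x ⟨s(p, r), (wheel n).mem_edgeSet.mpr h3⟩ ≤ 0) ∧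
          (x ⟨s(p, q), (wheel n).mem_edgeSet.mpr h1⟩
              + x ⟨s(q, r), (wheel n).mem_edgeSet.mpr h2⟩
              + x ⟨s(p, r), (wheel n).mem_edgeSet.mpr h3⟩ ≤ 2)) ∧
        (∀ e : ↥(wheel n).edgeSet, (e : Sym2 (Option (ZMod n))) ∈ rimEdges n →
          x e ≤ ∑ f ∈ Finset.univ.filter
            (fun f : ↥(wheel n).edgeSet =>
              (f : Sym2 (Option (ZMod n))) ∈ rimEdges n ∧ f ≠ e), x f) ∧
        (∑ e ∈ Finset.univ.filter
            (fun f : ↥(wheel n).edgeSet => (f : Sym2 (Option (ZMod n))) ∈ rimEdges n),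
          x e ≤ 2)} := by
  ext x
  have hrim : ∀ x : ↥(wheel n).edgeSet → ℝ,
      (∀ e : ↥(wheel n).edgeSet, (e : Sym2 (Option (ZMod n))) ∈ rimEdges n →
        x e ≤ ∑ f ∈ Finset.univ.filter (fun f : ↥(wheel n).edgeSet =>
          (f : Sym2 (Option (ZMod n))) ∈ rimEdges n ∧ f ≠ e), x f) ↔
        ∀ i, x (rim hn i) ≤ ∑ j, x (rim hn j) - x (rim hn i) := by
    intro x
    constructor
    · intro h i
      rw [← sum_rimEdges_ne hn]
      exact h _ (rim_mem_rimEdges hn i)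
    · intro h e he
      obtain ⟨i, rfl⟩ := exists_rim_of_mem hn he
      rw [sum_rimEdges_ne hn]
      exact h i
  simp only [hrim, sum_rimEdges hn]
  constructor
  · intro hx
    refine convexHull_min ?_ ?_ hx
    · rintro _ ⟨D, hD, rfl⟩
      obtain ⟨S, hS, hexit⟩ := exists_rimVec_of_isBond hn hD
      rw [hS]
      exact ⟨fun p q r h1 h2 h3 => indVec_cut_triangle _ _ _ _ _, rimVec_rim_le hn S,
        sum_rimVec_rim_le_two hn hexit⟩
    · rintro u ⟨hu1, hu2, hu3⟩ v ⟨hv1, hv2, hv3⟩ s t hs ht hst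
      obtain rfl : t = 1 - s := by linarith
      refine ⟨fun p q r h1 h2 h3 => ⟨?_, ?_⟩, fun i => ?_, ?_⟩ <;>
        simp only [Pi.add_apply, Pi.smul_apply, smul_eq_mul, Finset.sum_add_distrib,
          ← Finset.mul_sum]
      · nlinarith [mul_le_mul_of_nonneg_left (hu1 p q r h1 h2 h3).1 hs,
          mul_le_mul_of_nonneg_left (hv1 p q r h1 h2 h3).1 ht]
      · nlinarith [mul_le_mul_of_nonneg_left (hu1 p q r h1 h2 h3).2 hs,
          mul_le_mul_of_nonneg_left (hv1 p q r h1 h2 h3).2 ht]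
      · nlinarith [mul_le_mul_of_nonneg_left (hu2 i) hs, mul_le_mul_of_nonneg_left (hv2 i) ht]
      · nlinarith [mul_le_mul_of_nonneg_left hu3 hs, mul_le_mul_of_nonneg_left hv3 ht]
  · rintro ⟨h1, h2, h3⟩
    have hswap : ∀ i : ZMod n, x ⟨s(some i, none),
        (wheel n).mem_edgeSet.mpr (wheel_adj_none_some i).symm⟩ = x (spoke i) :=
      fun i => congrArg x (Subtype.ext Sym2.eq_swap)
    have htri : ∀ i, x (spoke i) - x (rim hn i) - x (spoke (i + 1)) ≤ 0 ∧
        x (spoke i) + x (rim hn i) + x (spoke (i + 1)) ≤ 2 := fun i =>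
      h1 none (some i) (some (i + 1)) (wheel_adj_none_some i) (wheel_adj_some_succ hn i)
        (wheel_adj_none_some (i + 1))
    have hrev : ∀ i, x (spoke (i + 1)) - x (rim hn i) - x (spoke i) ≤ 0 := by
      intro i
      have h := (h1 none (some (i + 1)) (some i) (wheel_adj_none_some (i + 1))
        (wheel_adj_some_succ hn i).symm (wheel_adj_none_some i)).1
      have he : x ⟨s(some (i + 1), some i),
          (wheel n).mem_edgeSet.mpr (wheel_adj_some_succ hn i).symm⟩ = x (rim hn i) :=
        congrArg x (Subtype.ext Sym2.eq_swap)
      rw [he] at h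
      exact h
    have hbase : ∀ i, x (rim hn i) - x (spoke (i + 1)) - x (spoke i) ≤ 0 := by
      intro i
      have h := (h1 (some i) (some (i + 1)) none (wheel_adj_some_succ hn i)
        (wheel_adj_none_some (i + 1)).symm (wheel_adj_none_some i).symm).1
      rw [hswap, hswap] at h
      exact h
    refine mem_bondPolytope_of_inequalities hn (fun i => abs_le.2 ⟨?_, ?_⟩) (fun i => ?_)
      (fun i => ?_) h2 h3
    · linarith [(htri i).1]
    · linarith [hrev i]
    · linarith [hbase i]
    · linarith [(htri i).2]

end BondPolytope
end
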